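/- Let 𝒳, 𝒴 be finite sets with |𝒳| ≥ 2 and |𝒴| ≥ 2, let n ≥ 27, and let ε ∈ ((4|𝒳||𝒴|/n)·log₂ n, 1). There exists a set 𝒫̃ ⊆ 𝒫(𝒴|𝒳) with |𝒫̃| ≤ (|𝒴|·(1 + ⌊4|𝒴|²/ε⌋))^{|𝒳||𝒴|} such that for every w ∈ 𝒫(𝒴|𝒳) there is a w̃ ∈ 𝒫̃ with the following property: whenever M is a finitely supported random variable, 𝐗 is a random variable on 𝒳^n, 𝐘_w and 𝐘_{w̃} are outputs of 𝐗 through w^n and w̃^n respectively with M ⊸ 𝐗 ⊸ 𝐘_w and M ⊸ 𝐗 ⊸ 𝐘_{w̃}, and δ, α > 0 satisfy Pr(|h(𝐘_{w̃}|M) − H(𝐘_{w̃}|M)| > nδ) < 2^{−nα}, then Pr(|h(𝐘_w|M) − H(𝐘_w|M)| > nδ̃) < 2^{−nε} + 2^{−n(α−ε)}, where δ̃ = (2 + 2^{−nε} + 2^{−n(α−ε)})·(δ+ε) + (2^{−nε} + 2^{−n(α−ε)})·(log₂|𝒴| − (2/n)·log₂(2^{−nε} + 2^{−n(α−ε)})).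 -/

import Mathlib

open scoped Classical BigOperators

noncomputable section

namespace Paper

variable {Ω : Type*}

/-- Probability of an event under a discrete probability distribution. -/
def pr (μ : PMF Ω) (E : Set Ω) : ℝ := (μ.toOuterMeasure E).toReal

/-- Conditional probability `Pr(E | F)`. -/
def cpr (μ : PMF Ω) (E F : Set Ω) : ℝ := pr μ (E ∩ F) / pr μ F

/-- Entropy spectrum frequency `h_X(x) = -log₂ Pr(X = x)`. -/
def hs {α : Type*} (μ : PMF Ω) (X : Ω → α) (x : α) : ℝ :=
  - Real.logb 2 (pr μ {ω | X ω = x})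

/-- Conditional entropy spectrum frequency `h_{X|Y}(x|y) = -log₂ Pr(X = x | Y = y)`. -/
def hcs {α β : Type*} (μ : PMF Ω) (X : Ω → α) (Y : Ω → β) (x : α) (y : β) : ℝ :=
  - Real.logb 2 (cpr μ {ω | X ω = x} {ω | Y ω = y})

/-- Conditional Shannon entropy (bits) `H(X|Y)`. -/
def Hc {α β : Type*} [Fintype α] [Fintype β] (μ : PMF Ω) (X : Ω → α) (Y : Ω → β) : ℝ :=
  - ∑ x : α, ∑ y : β, pr μ ({ω | X ω = x} ∩ {ω | Y ω = y}) *
      Real.logb 2 (cpr μ {ω | X ω = x} {ω | Y ω = y})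

/-- Shannon entropy (bits) of `X` conditioned on the event `E`. -/
def HEvt {α : Type*} [Fintype α] (μ : PMF Ω) (X : Ω → α) (E : Set Ω) : ℝ :=
  - ∑ x : α, cpr μ {ω | X ω = x} E * Real.logb 2 (cpr μ {ω | X ω = x} E)

/-- Conditional Shannon entropy (bits) `H(X|Y)` computed given the event `E`. -/
def HcEvt {α β : Type*} [Fintype α] [Fintype β] (μ : PMF Ω) (X : Ω → α) (Y : Ω → β)
    (E : Set Ω) : ℝ :=
  - ∑ x : α, ∑ y : β, cpr μ ({ω | X ω = x} ∩ {ω | Y ω = y}) E *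
      Real.logb 2 (cpr μ {ω | X ω = x} ({ω | Y ω = y} ∩ E))

/-- `A ⊸ B ⊸ C` : `A` and `C` are conditionally independent given `B`. -/
def Markov {α β γ : Type*} (μ : PMF Ω) (A : Ω → α) (B : Ω → β) (C : Ω → γ) : Prop :=
  ∀ a b c, pr μ {ω | A ω = a ∧ B ω = b ∧ C ω = c} * pr μ {ω | B ω = b} =
    pr μ {ω | A ω = a ∧ B ω = b} * pr μ {ω | B ω = b ∧ C ω = c}

/-- A discrete memoryless channel from `𝒳` to `𝒴`. -/
structure Channel (𝒳 𝒴 : Type*) [Fintype 𝒴] where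
  w : 𝒳 → 𝒴 → ℝ
  nonneg : ∀ x y, 0 ≤ w x y
  sum_one : ∀ x, ∑ y, w x y = 1

/-- The `n`-fold product channel `W^n(𝐲|𝐱)`. -/
def Channel.pn {𝒳 𝒴 : Type*} [Fintype 𝒴] (W : Channel 𝒳 𝒴) (n : ℕ)
    (x : Fin n → 𝒳) (y : Fin n → 𝒴) : ℝ := ∏ i, W.w (x i) (y i)

/-- `Y` is an output of `X` through `W^n`. -/
def IsOutput {𝒳 𝒴 : Type*} [Fintype 𝒴] {n : ℕ} (μ : PMF Ω)
    (X : Ω → Fin n → 𝒳) (Y : Ω → Fin n → 𝒴) (W : Channel 𝒳 𝒴) : Prop :=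
  ∀ x y, 0 < pr μ {ω | X ω = x} → cpr μ {ω | Y ω = y} {ω | X ω = x} = W.pn n x y

/-- `W^n(B|𝐱)`. -/
def imgMass {𝒳 𝒴 : Type*} [Fintype 𝒴] (W : Channel 𝒳 𝒴) (n : ℕ)
    (x : Fin n → 𝒳) (B : Finset (Fin n → 𝒴)) : ℝ := ∑ y ∈ B, W.pn n x y

/-- `B` is an `η`-image of `A` by `W`. -/
def IsImage {𝒳 𝒴 : Type*} [Fintype 𝒴] (W : Channel 𝒳 𝒴) (n : ℕ)
    (A : Set (Fin n → 𝒳)) (η : ℝ) (B : Finset (Fin n → 𝒴)) : Prop :=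
  ∀ x ∈ A, η ≤ imgMass W n x B

/-- Minimum cardinality of an `η`-image of `A` by `W`. -/
def gimg {𝒳 𝒴 : Type*} [Fintype 𝒴] (W : Channel 𝒳 𝒴) (n : ℕ)
    (A : Set (Fin n → 𝒳)) (η : ℝ) : ℕ :=
  sInf {k | ∃ B : Finset (Fin n → 𝒴), IsImage W n A η B ∧ B.card = k}

/-- `B` is an `η`-quasi-image of the pmf `P` by `W`. -/
def IsQImage {𝒳 𝒴 : Type*} [Fintype 𝒳] [Fintype 𝒴] (W : Channel 𝒳 𝒴) (n : ℕ)
    (P : (Fin n → 𝒳) → ℝ) (η : ℝ) (B : Finset (Fin n → 𝒴)) : Prop :=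
  η ≤ ∑ x, imgMass W n x B * P x

/-- Minimum cardinality of an `η`-quasi-image of `P` by `W`. -/
def gqimg {𝒳 𝒴 : Type*} [Fintype 𝒳] [Fintype 𝒴] (W : Channel 𝒳 𝒴) (n : ℕ)
    (P : (Fin n → 𝒳) → ℝ) (η : ℝ) : ℕ :=
  sInf {k | ∃ B : Finset (Fin n → 𝒴), IsQImage W n P η B ∧ B.card = k}

/-- The number of values in the support of `U`. -/
def suppCard {α : Type*} [Fintype α] (μ : PMF Ω) (U : Ω → α) : ℕ :=
  (Finset.univ.filter (fun u => 0 < pr μ {ω | U ω = u})).card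

/-- Mutual information (bits). -/
def MI {α β : Type*} [Fintype α] [Fintype β] (μ : PMF Ω) (A : Ω → α) (B : Ω → β) : ℝ :=
  ∑ a : α, ∑ b : β, pr μ {ω | A ω = a ∧ B ω = b} *
    Real.logb 2 (pr μ {ω | A ω = a ∧ B ω = b} / (pr μ {ω | A ω = a} * pr μ {ω | B ω = b}))

/-- Conditional mutual information (bits). -/
def CMI {α β γ : Type*} [Fintype α] [Fintype β] [Fintype γ] (μ : PMF Ω)
    (A : Ω → α) (B : Ω → β) (C : Ω → γ) : ℝ :=
  ∑ c : γ, pr μ {ω | C ω = c} * ∑ a : α, ∑ b : β,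
    cpr μ {ω | A ω = a ∧ B ω = b} {ω | C ω = c} *
      Real.logb 2 (cpr μ {ω | A ω = a ∧ B ω = b} {ω | C ω = c} /
        (cpr μ {ω | A ω = a} {ω | C ω = c} * cpr μ {ω | B ω = b} {ω | C ω = c}))

/-- `D_{wh}(w‖w'|p̂)` in the extended reals, with the stated conventions. -/
def Dkl {𝒳 𝒴 : Type*} [Fintype 𝒳] [Fintype 𝒴] (w w' wh : Channel 𝒳 𝒴)
    (p : 𝒳 → ℝ) : EReal :=
  if ∃ x y, 0 < wh.w x y * p x ∧ w'.w x y = 0 ∧ 0 < w.w x y then ⊤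
  else if ∃ x y, 0 < wh.w x y * p x ∧ w.w x y = 0 ∧ 0 < w'.w x y then ⊥
  else ((∑ x : 𝒳, ∑ y : 𝒴, wh.w x y * p x * Real.logb 2 (w.w x y / w'.w x y) : ℝ) : EReal)

/-- `sup { D_{wh}(w‖w'|p̂) }` over channels `wh` and pmfs `p̂` on `𝒳`. -/
def DklSup {𝒳 𝒴 : Type*} [Fintype 𝒳] [Fintype 𝒴] (w w' : Channel 𝒳 𝒴) : EReal :=
  sSup {d : EReal | ∃ (wh : Channel 𝒳 𝒴) (p : 𝒳 → ℝ),
    (∀ x, 0 ≤ p x) ∧ (∑ x, p x = 1) ∧ d = Dkl w w' wh p}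

section FiniteDistributions

lemma mul_neg_logb_nonneg {ι : Type*} {P g : ι → ℝ} (hP : ∀ i, 0 ≤ P i) (hPg : ∀ i, P i ≤ g i)
    (i : ι) :
    0 ≤ P i * -Real.logb 2 (P i / g i) := by
  have hgi : 0 ≤ g i := (hP i).trans (hPg i)
  refine mul_nonneg (hP i) (neg_nonneg.2 ?_)
  exact Real.logb_nonpos (by norm_num) (div_nonneg (hP i) hgi) (div_le_one_of_le₀ (hPg i) hgi)

variable {ι : Type*} [Fintype ι] {P P' g : ι → ℝ} {L H H' a d q : ℝ}

/-- The contribution of an event of probability `p` to a conditional entropy whose reference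
weights `g` have total mass `2 ^ L` is at most `p * L - p * log₂ p`. -/
lemma sum_mul_neg_logb_le (hP : ∀ i, 0 ≤ P i) (hPg : ∀ i, P i ≤ g i)
    (hg : ∑ i, g i = 2 ^ L) (s : Finset ι) :
    ∑ i ∈ s, P i * -Real.logb 2 (P i / g i) ≤
      (∑ i ∈ s, P i) * L - (∑ i ∈ s, P i) * Real.logb 2 (∑ i ∈ s, P i) := by
  set p := ∑ i ∈ s, P i with hp
  have hlog2 : 0 < Real.log 2 := Real.log_pos (by norm_num)
  have hN : (0 : ℝ) < 2 ^ L := by positivity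
  rcases (Finset.sum_nonneg fun i (_ : i ∈ s) => hP i).eq_or_lt with h0 | hpos
  · have hz := (Finset.sum_eq_zero_iff_of_nonneg fun i (_ : i ∈ s) => hP i).1 h0.symm
    rw [Finset.sum_eq_zero fun i hi => by rw [hz i hi, zero_mul], hp, ← h0]
    simp
  replace hpos : 0 < p := hpos
  have key : ∀ i ∈ s, P i * -Real.log (P i / g i) ≤
      P i * (L * Real.log 2 - Real.log p) + (g i * (p / 2 ^ L) - P i) := by
    intro i _
    have hgi : 0 ≤ g i := (hP i).trans (hPg i)
    rcases (hP i).eq_or_lt with h | h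
    · rw [← h]
      have : 0 ≤ g i * (p / 2 ^ L) := by positivity
      simpa using this
    · have hg0 : 0 < g i := h.trans_le (hPg i)
      have h1 := Real.log_le_sub_one_of_pos (x := g i * (p / 2 ^ L) / P i) (by positivity)
      rw [Real.log_div (by positivity) h.ne', Real.log_mul hg0.ne' (by positivity),
        Real.log_div hpos.ne' hN.ne', Real.log_rpow (by norm_num)] at h1
      have h2 := mul_le_mul_of_nonneg_left h1 h.le
      rw [mul_sub, mul_sub, mul_one, mul_div_cancel₀ _ h.ne'] at h2
      rw [Real.log_div h.ne' hg0.ne']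
      linarith
  have hsum := Finset.sum_le_sum key
  rw [Finset.sum_add_distrib, ← Finset.sum_mul, Finset.sum_sub_distrib, ← Finset.sum_mul,
    ← hp] at hsum
  have hgs : ∑ i ∈ s, g i ≤ 2 ^ L := hg ▸ Finset.sum_le_sum_of_subset_of_nonneg
    (Finset.subset_univ s) fun i _ _ => (hP i).trans (hPg i)
  have hgp : (∑ i ∈ s, g i) * (p / 2 ^ L) ≤ p := by
    calc _ ≤ 2 ^ L * (p / 2 ^ L) := by gcongr
      _ = p := by field_simp
  have hconv : ∑ i ∈ s, P i * -Real.logb 2 (P i / g i) =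
      (∑ i ∈ s, P i * -Real.log (P i / g i)) / Real.log 2 := by
    rw [Finset.sum_div]
    refine Finset.sum_congr rfl fun i _ => ?_
    rw [Real.logb]
    ring
  rw [hconv, div_le_iff₀ hlog2, Real.logb]
  have : (p * L - p * (Real.log p / Real.log 2)) * Real.log 2 =
      p * (L * Real.log 2 - Real.log p) := by
    field_simp
  linarith

/-- The map `p ↦ p * L - p * log₂ p` is monotone on `[0, 1]` as soon as `2 ≤ L`. -/
lemma mul_sub_mul_logb_mono {p t : ℝ} (hp : 0 ≤ p) (hpt : p ≤ t) (ht : t ≤ 1) (hL : 2 ≤ L) :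
    p * L - p * Real.logb 2 p ≤ t * L - t * Real.logb 2 t := by
  have hlog2 : 0 < Real.log 2 := Real.log_pos (by norm_num)
  have ht0 : Real.logb 2 t ≤ 0 := Real.logb_nonpos (by norm_num) (hp.trans hpt) ht
  rcases hp.eq_or_lt with rfl | hp
  · have h1 : 0 ≤ t * L := mul_nonneg hpt (by linarith)
    have h2 : t * Real.logb 2 t ≤ 0 := mul_nonpos_of_nonneg_of_nonpos hpt ht0
    simp only [zero_mul, sub_zero]
    linarith
  · have htp : 0 < t := hp.trans_le hpt
    have h1 := Real.log_le_sub_one_of_pos (x := t / p) (by positivity)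
    rw [Real.log_div htp.ne' hp.ne'] at h1
    have h2 := mul_le_mul_of_nonneg_left h1 hp.le
    rw [mul_sub p (t / p), mul_one, mul_div_cancel₀ _ hp.ne'] at h2
    have h3 : p * (Real.logb 2 t - Real.logb 2 p) ≤ (t - p) * 2 := by
      rw [Real.logb, Real.logb, ← sub_div, ← mul_div_assoc, div_le_iff₀ hlog2]
      nlinarith [Real.log_two_gt_d9]
    nlinarith

/-- If `P ≤ 2 ^ a * P'` pointwise and the self-information under `P'` concentrates around `H'`
within `d`, then the self-information under `P` concentrates around `H'` within `d + a`. -/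
lemma sum_filter_abs_sub_gt_lt (hP : ∀ i, 0 ≤ P i) (hPg : ∀ i, P i ≤ g i)
    (hP' : ∀ i, 0 ≤ P' i) (hP's : ∑ i, P' i = 1) (hPP' : ∀ i, P i ≤ 2 ^ a * P' i)
    (hq : ∑ i with |-Real.logb 2 (P' i / g i) - H'| > d, P' i < q) :
    ∑ i with |-Real.logb 2 (P i / g i) - H'| > d + a, P i < 2 ^ (-a) + 2 ^ a * q := by
  have hE : (0 : ℝ) < 2 ^ a := by positivity
  have key : ∀ i, (if |-Real.logb 2 (P i / g i) - H'| > d + a then P i else 0) ≤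
      2 ^ (-a) * P' i +
        2 ^ a * (if |-Real.logb 2 (P' i / g i) - H'| > d then P' i else 0) := by
    intro i
    have h0 : 0 ≤ 2 ^ (-a) * P' i := mul_nonneg (by positivity) (hP' i)
    have h0' : 0 ≤ 2 ^ a * (if |-Real.logb 2 (P' i / g i) - H'| > d then P' i else 0) := by
      refine mul_nonneg hE.le ?_
      split_ifs
      exacts [hP' i, le_rfl]
    split_ifs at h0' ⊢ with h1 h2 h2
    · linarith [hPP' i]
    · rcases (hP i).eq_or_lt with h | h
      · linarith
      have hg0 : 0 < g i := h.trans_le (hPg i)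
      have hP0 : 0 < P' i := pos_of_mul_pos_right (h.trans_le (hPP' i)) hE.le
      have hl : Real.logb 2 (P i / g i) ≤ a + Real.logb 2 (P' i / g i) := by
        have := Real.logb_le_logb_of_le (b := 2) (by norm_num) h (hPP' i)
        rw [Real.logb_mul hE.ne' hP0.ne', Real.logb_rpow (by norm_num) (by norm_num)] at this
        rw [Real.logb_div h.ne' hg0.ne', Real.logb_div hP0.ne' hg0.ne']
        linarith
      obtain ⟨h3, h4⟩ := abs_le.1 (not_lt.1 h2)
      have h5 : Real.logb 2 (P i / g i) < -a + Real.logb 2 (P' i / g i) := by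
        rcases lt_abs.1 h1 with h6 | h6 <;> linarith
      rw [Real.logb_div h.ne' hg0.ne', Real.logb_div hP0.ne' hg0.ne'] at h5
      have h7 : Real.logb 2 (P i) < Real.logb 2 (2 ^ (-a) * P' i) := by
        rw [Real.logb_mul (by positivity) hP0.ne', Real.logb_rpow (by norm_num) (by norm_num)]
        linarith
      have := (Real.logb_lt_logb_iff (b := 2) (by norm_num) h (by positivity)).1 h7
      linarith
    · linarith
    · linarith
  have hsum := Finset.sum_le_sum fun i (_ : i ∈ Finset.univ) => key i
  rw [Finset.sum_add_distrib, ← Finset.mul_sum, ← Finset.mul_sum, hP's, ← Finset.sum_filter,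
    ← Finset.sum_filter] at hsum
  have := mul_lt_mul_of_pos_left hq hE
  linarith

/-- The mean of the self-information differs from a center of concentration `H'` by at most the
width `T` plus a term controlled by the probability of deviation. -/
lemma abs_sum_sub_le {T : ℝ} (hP : ∀ i, 0 ≤ P i) (hPg : ∀ i, P i ≤ g i) (hPs : ∑ i, P i = 1)
    (hg : ∑ i, g i = 2 ^ L) (hT : 0 ≤ T) (hH0 : 0 ≤ H') (hHL : H' ≤ L) {p : ℝ}
    (hp : ∑ i with |-Real.logb 2 (P i / g i) - H'| > T, P i = p) :
    |∑ i, P i * -Real.logb 2 (P i / g i) - H'| ≤ T + (p * L - p * Real.logb 2 p) := by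
  have hp0 : 0 ≤ p := hp ▸ Finset.sum_nonneg fun i _ => hP i
  have hp1 : p ≤ 1 := by
    rw [← hp, ← hPs]
    exact Finset.sum_le_sum_of_subset_of_nonneg (Finset.subset_univ _) fun i _ _ => hP i
  have hplog : p * Real.logb 2 p ≤ 0 :=
    mul_nonpos_of_nonneg_of_nonpos hp0 (Real.logb_nonpos (by norm_num) hp0 hp1)
  have hsplit : ∑ i, P i * -Real.logb 2 (P i / g i) - H' =
      ∑ i, P i * (-Real.logb 2 (P i / g i) - H') := by
    simp_rw [mul_sub, Finset.sum_sub_distrib, ← Finset.sum_mul, hPs, one_mul]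
  rw [hsplit, ← Finset.sum_filter_add_sum_filter_not Finset.univ
    (fun i => |-Real.logb 2 (P i / g i) - H'| > T)]
  have hbad : ∑ i with |-Real.logb 2 (P i / g i) - H'| > T,
      P i * (-Real.logb 2 (P i / g i) - H') =
      ∑ i with |-Real.logb 2 (P i / g i) - H'| > T, P i * -Real.logb 2 (P i / g i)
        - p * H' := by
    simp_rw [mul_sub, Finset.sum_sub_distrib, ← Finset.sum_mul, hp]
  have hupper := sum_mul_neg_logb_le hP hPg hg
    (Finset.univ.filter fun i => |-Real.logb 2 (P i / g i) - H'| > T)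
  rw [hp] at hupper
  have hlower := Finset.sum_nonneg fun i
    (_ : i ∈ Finset.univ.filter fun i => |-Real.logb 2 (P i / g i) - H'| > T) =>
      mul_neg_logb_nonneg hP hPg i
  have hgood : |∑ i with ¬ |-Real.logb 2 (P i / g i) - H'| > T,
      P i * (-Real.logb 2 (P i / g i) - H')| ≤ T := by
    calc _ ≤ ∑ i with ¬ |-Real.logb 2 (P i / g i) - H'| > T, P i * T := by
          refine (Finset.abs_sum_le_sum_abs _ _).trans (Finset.sum_le_sum fun i hi => ?_)
          rw [abs_mul, abs_of_nonneg (hP i)]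
          exact mul_le_mul_of_nonneg_left (not_lt.1 (Finset.mem_filter.1 hi).2) (hP i)
      _ ≤ ∑ i, P i * T := Finset.sum_le_sum_of_subset_of_nonneg (Finset.filter_subset _ _)
          fun i _ _ => mul_nonneg (hP i) hT
      _ = T := by rw [← Finset.sum_mul, hPs, one_mul]
  rw [hbad]
  obtain ⟨h1, h2⟩ := abs_le.1 hgood
  have h3 : p * H' ≤ p * L := mul_le_mul_of_nonneg_left hHL hp0
  have h4 : 0 ≤ p * H' := mul_nonneg hp0 hH0
  exact abs_le.2 ⟨by linarith, by linarith⟩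

/-- Concentration of the self-information around its mean transfers from `P'` to `P` when
`P ≤ 2 ^ a * P'` pointwise. -/
lemma concentration_transfer (hP : ∀ i, 0 ≤ P i) (hPg : ∀ i, P i ≤ g i) (hPs : ∑ i, P i = 1)
    (hP' : ∀ i, 0 ≤ P' i) (hP'g : ∀ i, P' i ≤ g i) (hP's : ∑ i, P' i = 1)
    (hg : ∑ i, g i = 2 ^ L) (hL : 2 ≤ L) (ha : 0 ≤ a) (hd : 0 ≤ d)
    (hPP' : ∀ i, P i ≤ 2 ^ a * P' i)
    (hH : H = ∑ i, P i * -Real.logb 2 (P i / g i))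
    (hH' : H' = ∑ i, P' i * -Real.logb 2 (P' i / g i))
    (hq : ∑ i with |-Real.logb 2 (P' i / g i) - H'| > d, P' i < q)
    {t : ℝ} (ht : t = 2 ^ (-a) + 2 ^ a * q) :
    ∑ i with |-Real.logb 2 (P i / g i) - H| > (2 + t) * (d + a) + t * L - 2 * t * Real.logb 2 t,
      P i < t := by
  rcases lt_or_ge 1 t with h1 | h1
  · refine lt_of_le_of_lt ?_ h1
    rw [← hPs]
    exact Finset.sum_le_sum_of_subset_of_nonneg (Finset.subset_univ _) fun i _ _ => hP i
  have hH0 : 0 ≤ H' := hH' ▸ Finset.sum_nonneg fun i _ => mul_neg_logb_nonneg hP' hP'g i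
  have hHL : H' ≤ L := by
    have := sum_mul_neg_logb_le hP' hP'g hg Finset.univ
    rw [hP's, ← hH'] at this
    simpa using this
  have hlt := sum_filter_abs_sub_gt_lt hP hPg hP' hP's hPP' hq
  rw [← ht] at hlt
  obtain ⟨p, hp⟩ : ∃ p, ∑ i with |-Real.logb 2 (P i / g i) - H'| > d + a, P i = p := ⟨_, rfl⟩
  have hp0 : 0 ≤ p := hp ▸ Finset.sum_nonneg fun i _ => hP i
  have hdist := abs_sum_sub_le hP hPg hPs hg (add_nonneg hd ha) hH0 hHL hp
  rw [← hH] at hdist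
  rw [hp] at hlt
  have hmono := mul_sub_mul_logb_mono hp0 hlt.le h1 hL
  have ht0 : 0 ≤ t := hp0.trans hlt.le
  have htlog : t * Real.logb 2 t ≤ 0 :=
    mul_nonpos_of_nonneg_of_nonpos ht0 (Real.logb_nonpos (by norm_num) ht0 h1)
  have htT : 0 ≤ t * (d + a) := mul_nonneg ht0 (add_nonneg hd ha)
  refine lt_of_le_of_lt ?_ (hp.trans_lt hlt)
  refine Finset.sum_le_sum_of_subset_of_nonneg (fun i hi => ?_) fun i _ _ => hP i
  simp only [Finset.mem_filter, Finset.mem_univ, true_and] at hi ⊢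
  have := abs_sub_le (-Real.logb 2 (P i / g i)) H' H
  rw [abs_sub_comm H' H] at this
  linarith

end FiniteDistributions

section Probability

lemma pr_nonneg (μ : PMF Ω) (E : Set Ω) : 0 ≤ pr μ E := ENNReal.toReal_nonneg

lemma pr_eq_measureReal (μ : PMF Ω) (E : Set Ω) :
    pr μ E = (@PMF.toMeasure Ω ⊤ μ).real E := by
  let _ : MeasurableSpace Ω := ⊤
  rw [pr, MeasureTheory.measureReal_def,
    PMF.toMeasure_apply_eq_toOuterMeasure_apply _ MeasurableSpace.measurableSet_top]

lemma pr_eq_sum_inter {γ : Type*} [Fintype γ] (μ : PMF Ω) (Z : Ω → γ) (E : Set Ω) :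
    pr μ E = ∑ z, pr μ (E ∩ {ω | Z ω = z}) := by
  simp_rw [pr_eq_measureReal]
  let _ : MeasurableSpace Ω := ⊤
  rw [← MeasureTheory.measureReal_biUnion_finset (s := Finset.univ)
    (f := fun z => E ∩ {ω | Z ω = z})]
  · congr 1
    ext ω
    simp
  · intro z _ z' _ hz
    refine Set.disjoint_left.2 fun ω h h' => hz ?_
    exact h.2.symm.trans h'.2
  · exact fun _ _ => MeasurableSpace.measurableSet_top

lemma pr_mono (μ : PMF Ω) {E F : Set Ω} (h : E ⊆ F) : pr μ E ≤ pr μ F := by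
  rw [pr_eq_measureReal, pr_eq_measureReal]
  exact MeasureTheory.measureReal_mono h

lemma pr_univ (μ : PMF Ω) : pr μ Set.univ = 1 := by
  rw [pr, (PMF.toOuterMeasure_apply_eq_one_iff _ _).2 (Set.subset_univ _), ENNReal.toReal_one]

lemma sum_pr_eq_one {γ : Type*} [Fintype γ] (μ : PMF Ω) (Z : Ω → γ) :
    ∑ z, pr μ {ω | Z ω = z} = 1 := by
  rw [← pr_univ μ, pr_eq_sum_inter μ Z Set.univ]
  simp

variable {α β : Type*} [Fintype α] [Fintype β]

lemma sum_pr_inter_eq_one (μ : PMF Ω) (Y : Ω → α) (M : Ω → β) :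
    ∑ i : α × β, pr μ ({ω | Y ω = i.1} ∩ {ω | M ω = i.2}) = 1 := by
  rw [Fintype.sum_prod_type]
  exact (Finset.sum_congr rfl fun y _ => (pr_eq_sum_inter μ M {ω | Y ω = y}).symm).trans
    (sum_pr_eq_one μ Y)

lemma pr_eq_sum_filter (μ : PMF Ω) (Y : Ω → α) (M : Ω → β) (Q : α → β → Prop) :
    pr μ {ω | Q (Y ω) (M ω)} =
      ∑ i : α × β with Q i.1 i.2, pr μ ({ω | Y ω = i.1} ∩ {ω | M ω = i.2}) := by
  rw [pr_eq_sum_inter μ (fun ω => (Y ω, M ω)), Finset.sum_filter]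
  refine Finset.sum_congr rfl fun i _ => ?_
  split_ifs with h
  · congr 1
    ext ω
    simp only [Set.mem_inter_iff, Set.mem_ofPred_eq, Prod.ext_iff]
    constructor
    · exact fun h' => h'.2
    · rintro ⟨h1, h2⟩
      exact ⟨by rwa [h1, h2], h1, h2⟩
  · have : {ω | Q (Y ω) (M ω)} ∩ {ω | (Y ω, M ω) = i} = ∅ := by
      ext ω
      simp only [Set.mem_inter_iff, Set.mem_ofPred_eq, Set.mem_empty_iff_false, iff_false,
        not_and]
      rintro h1 rfl
      exact h h1
    rw [this]
    simp [pr]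

lemma Hc_eq_sum (μ : PMF Ω) (Y : Ω → α) (M : Ω → β) :
    Hc μ Y M = ∑ i : α × β, pr μ ({ω | Y ω = i.1} ∩ {ω | M ω = i.2}) *
      -Real.logb 2 (pr μ ({ω | Y ω = i.1} ∩ {ω | M ω = i.2}) / pr μ {ω | M ω = i.2}) := by
  simp_rw [Fintype.sum_prod_type, Hc, cpr, mul_neg, Finset.sum_neg_distrib]

/-- The joint law of a channel output and a variable that forms a Markov chain with it. -/
lemma pr_output_inter {𝒳 𝒴 γ : Type*} [Fintype 𝒳] [Fintype 𝒴] {n : ℕ} {μ : PMF Ω}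
    {X : Ω → Fin n → 𝒳} {Y : Ω → Fin n → 𝒴} {M : Ω → γ} {W : Channel 𝒳 𝒴}
    (hY : IsOutput μ X Y W) (hM : Markov μ M X Y) (y : Fin n → 𝒴) (m : γ) :
    pr μ ({ω | Y ω = y} ∩ {ω | M ω = m}) =
      ∑ x, pr μ {ω | M ω = m ∧ X ω = x} * W.pn n x y := by
  rw [pr_eq_sum_inter μ X]
  refine Finset.sum_congr rfl fun x _ => ?_
  have hset : {ω | Y ω = y} ∩ {ω | M ω = m} ∩ {ω | X ω = x} =
      {ω | M ω = m ∧ X ω = x ∧ Y ω = y} := by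
    ext ω
    simp only [Set.mem_inter_iff, Set.mem_ofPred_eq]
    tauto
  rw [hset]
  rcases (pr_nonneg μ {ω | X ω = x}).eq_or_lt with h | h
  · have h1 : pr μ {ω | M ω = m ∧ X ω = x ∧ Y ω = y} = 0 :=
      le_antisymm (h ▸ pr_mono μ fun ω hω => hω.2.1) (pr_nonneg _ _)
    have h2 : pr μ {ω | M ω = m ∧ X ω = x} = 0 :=
      le_antisymm (h ▸ pr_mono μ fun ω hω => hω.2) (pr_nonneg _ _)
    rw [h1, h2, zero_mul]
  · have h1 := hM m x y
    have h2 := hY x y h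
    rw [cpr, div_eq_iff h.ne'] at h2
    have h3 : {ω | X ω = x ∧ Y ω = y} = {ω | Y ω = y} ∩ {ω | X ω = x} := by
      ext ω
      exact and_comm
    rw [h3, h2, ← mul_assoc] at h1
    exact mul_right_cancel₀ h.ne' h1

lemma Channel.pn_le_rpow_mul_pn {𝒳 𝒴 : Type*} [Fintype 𝒴] {w w' : Channel 𝒳 𝒴} {ε : ℝ}
    (h : ∀ x y, w.w x y ≤ 2 ^ ε * w'.w x y) (n : ℕ) (x : Fin n → 𝒳) (y : Fin n → 𝒴) :
    w.pn n x y ≤ 2 ^ (n * ε) * w'.pn n x y := by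
  calc w.pn n x y ≤ ∏ i, 2 ^ ε * w'.w (x i) (y i) :=
        Finset.prod_le_prod (fun i _ => w.nonneg _ _) fun i _ => h _ _
    _ = 2 ^ (n * ε) * w'.pn n x y := by
        rw [Finset.prod_mul_distrib, Finset.prod_const, Finset.card_univ, Fintype.card_fin,
          mul_comm (n : ℝ) ε, Real.rpow_mul_natCast (by norm_num), Channel.pn]

end Probability

section Quantization

variable {𝒳 𝒴 : Type*} [Fintype 𝒴]

/-- The channels all of whose transition probabilities are multiples of `1 / N`. -/
def gridChannels (𝒳 𝒴 : Type*) [Fintype 𝒴] (N : ℕ) : Set (Channel 𝒳 𝒴) :=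
  {c | ∃ k : 𝒳 → 𝒴 → Fin (N + 1), ∀ x y, c.w x y = (k x y : ℝ) / N}

lemma gridChannels_finite_and_ncard_le [Fintype 𝒳] (N : ℕ) :
    (gridChannels 𝒳 𝒴 N).Finite ∧
      (gridChannels 𝒳 𝒴 N).ncard ≤ (N + 1) ^ (Fintype.card 𝒳 * Fintype.card 𝒴) := by
  choose k hk using fun c : gridChannels 𝒳 𝒴 N => c.2
  have hinj : Function.Injective k := by
    rintro ⟨⟨v, _, _⟩, hv⟩ ⟨⟨v', _, _⟩, hv'⟩ h
    have : v = v' := by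
      funext x y
      exact (hk ⟨⟨v, _, _⟩, hv⟩ x y).trans (h ▸ (hk ⟨⟨v', _, _⟩, hv'⟩ x y).symm)
    subst this
    rfl
  refine ⟨Set.finite_coe_iff.1 (Finite.of_injective k hinj), ?_⟩
  have := Nat.card_le_card_of_injective k hinj
  rw [← Nat.card_coe_set_eq]
  refine this.trans_eq ?_
  simp [Nat.card_eq_fintype_card, ← pow_mul, mul_comm]

lemma exists_grid_weights {v : 𝒴 → ℝ} (hv : ∀ y, 0 ≤ v y) (hvs : ∑ y, v y = 1) {ε : ℝ}
    (hε0 : 0 < ε) (hε1 : ε < 1) {N : ℕ} (hN : 2 * (Fintype.card 𝒴 : ℝ) ≤ N * ε) :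
    ∃ k : 𝒴 → ℕ, ∑ y, k y = N ∧ ∀ y, N * v y ≤ 2 ^ ε * k y := by
  have hbern : (2 : ℝ) ^ (-ε) ≤ 1 - ε / 2 := by
    have := rpow_one_add_le_one_add_mul_self (s := -1 / 2) (by norm_num) hε0.le hε1.le
    rw [Real.rpow_neg (by norm_num), ← Real.inv_rpow (by norm_num)]
    norm_num at this ⊢
    linarith
  have : Nonempty 𝒴 := by
    by_contra h
    rw [not_nonempty_iff] at h
    simp at hvs
  obtain ⟨y₀⟩ := this
  let c : 𝒴 → ℕ := fun y => ⌈N * v y * 2 ^ (-ε)⌉₊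
  have hc : ∑ y, c y ≤ N := by
    have h1 : ∀ y, (c y : ℝ) ≤ N * v y * 2 ^ (-ε) + 1 := fun y =>
      (Nat.ceil_lt_add_one (mul_nonneg (mul_nonneg N.cast_nonneg (hv y)) (by positivity))).le
    have h2 := Finset.sum_le_sum fun y (_ : y ∈ Finset.univ) => h1 y
    rw [Finset.sum_add_distrib, ← Finset.sum_mul, ← Finset.mul_sum, hvs] at h2
    simp only [mul_one, Finset.sum_const, Finset.card_univ, nsmul_eq_mul] at h2
    have h3 : (N : ℝ) * 2 ^ (-ε) ≤ N * (1 - ε / 2) :=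
      mul_le_mul_of_nonneg_left hbern N.cast_nonneg
    have h4 : ((∑ y, c y : ℕ) : ℝ) ≤ N := by
      push_cast
      linarith
    exact_mod_cast h4
  refine ⟨fun y => c y + if y = y₀ then N - ∑ y, c y else 0, ?_, fun y => ?_⟩
  · rw [Finset.sum_add_distrib, Finset.sum_ite_eq' Finset.univ y₀, if_pos (Finset.mem_univ _)]
    omega
  · have h1 : N * v y * 2 ^ (-ε) ≤ c y := Nat.le_ceil _
    have h2 : (c y : ℝ) ≤ ((c y + if y = y₀ then N - ∑ y, c y else 0 : ℕ) : ℝ) := by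
      exact_mod_cast Nat.le_add_right _ _
    calc N * v y = 2 ^ ε * (N * v y * 2 ^ (-ε)) := by
          rw [Real.rpow_neg (by norm_num)]
          field_simp
      _ ≤ _ := mul_le_mul_of_nonneg_left (h1.trans h2) (by positivity)

lemma exists_mem_gridChannels_le {ε : ℝ} (hε0 : 0 < ε) (hε1 : ε < 1) {N : ℕ} (hN0 : 0 < N)
    (hN : 2 * (Fintype.card 𝒴 : ℝ) ≤ N * ε) (w : Channel 𝒳 𝒴) :
    ∃ w' ∈ gridChannels 𝒳 𝒴 N, ∀ x y, w.w x y ≤ 2 ^ ε * w'.w x y := by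
  have hN0' : (0 : ℝ) < N := by exact_mod_cast hN0
  choose k hks hk using fun x => exists_grid_weights (w.nonneg x) (w.sum_one x) hε0 hε1 hN
  refine ⟨⟨fun x y => (k x y : ℝ) / N, fun x y => by positivity, fun x => ?_⟩,
    ⟨fun x y => ⟨k x y, ?_⟩, fun x y => rfl⟩, fun x y => ?_⟩
  · rw [← Finset.sum_div, ← Nat.cast_sum, hks, div_self hN0'.ne']
  · rw [Nat.lt_succ_iff, ← hks x]
    exact Finset.single_le_sum (f := k x) (fun _ _ => Nat.zero_le _) (Finset.mem_univ y)
  · rw [← mul_div_assoc, le_div_iff₀ hN0', mul_comm]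
    exact hk x y

end Quantization

/-- Theorem `lem:mt_aug:2`. -/
theorem exists_stability_extending_channel_set
    (𝒳 𝒴 : Type) [Fintype 𝒳] [Fintype 𝒴]
    (hX : 2 ≤ Fintype.card 𝒳) (hY : 2 ≤ Fintype.card 𝒴)
    (n : ℕ) (hn : 27 ≤ n) (ε : ℝ)
    (hε0 : (4 * (Fintype.card 𝒳) * (Fintype.card 𝒴) / n) * Real.logb 2 n < ε)
    (hε1 : ε < 1) :
    ∃ S : Set (Channel 𝒳 𝒴), S.Finite ∧
      S.ncard ≤
        ((Fintype.card 𝒴) * (1 + ⌊4 * (Fintype.card 𝒴 : ℝ) ^ 2 / ε⌋₊)) ^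
          ((Fintype.card 𝒳) * (Fintype.card 𝒴)) ∧
      ∀ w : Channel 𝒳 𝒴, ∃ w' ∈ S,
        ∀ (Ω : Type) (μ : PMF Ω) (𝓜 : Type) [Fintype 𝓜] (M : Ω → 𝓜)
          (X : Ω → Fin n → 𝒳) (Yw Yw' : Ω → Fin n → 𝒴),
          IsOutput μ X Yw w → IsOutput μ X Yw' w' →
          Markov μ M X Yw → Markov μ M X Yw' →
        ∀ δ α : ℝ, 0 < δ → 0 < α →
          pr μ {ω | |hcs μ Yw' M (Yw' ω) (M ω) - Hc μ Yw' M| > n * δ} <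
            2 ^ (-(n : ℝ) * α) →
          ∀ δt : ℝ,
            δt = (2 + 2 ^ (-(n : ℝ) * ε) + 2 ^ (-(n : ℝ) * (α - ε))) * (δ + ε) +
              (2 ^ (-(n : ℝ) * ε) + 2 ^ (-(n : ℝ) * (α - ε))) *
                (Real.logb 2 (Fintype.card 𝒴) -
                  (2 / n) * Real.logb 2 (2 ^ (-(n : ℝ) * ε) + 2 ^ (-(n : ℝ) * (α - ε)))) →
            pr μ {ω | |hcs μ Yw M (Yw ω) (M ω) - Hc μ Yw M| > n * δt} <
              2 ^ (-(n : ℝ) * ε) + 2 ^ (-(n : ℝ) * (α - ε)) := by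
  have hY0 : (2 : ℝ) ≤ Fintype.card 𝒴 := by exact_mod_cast hY
  have hn' : (27 : ℝ) ≤ n := by exact_mod_cast hn
  have hn0 : (0 : ℝ) < n := by linarith
  have hε : 0 < ε := by
    refine lt_of_le_of_lt (mul_nonneg (by positivity) ?_) hε0
    exact Real.logb_nonneg (by norm_num) (by linarith)
  obtain ⟨N, hNdef⟩ : ∃ N, N = ⌊4 * (Fintype.card 𝒴 : ℝ) ^ 2 / ε⌋₊ := ⟨_, rfl⟩
  have hN : 2 * (Fintype.card 𝒴 : ℝ) ≤ N * ε := by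
    have h1 := Nat.lt_floor_add_one (4 * (Fintype.card 𝒴 : ℝ) ^ 2 / ε)
    rw [← hNdef, div_lt_iff₀ hε] at h1
    nlinarith
  have hN0 : 0 < N := by
    rcases Nat.eq_zero_or_pos N with h | h
    · rw [h] at hN
      norm_num at hN
      linarith
    · exact h
  obtain ⟨hfin, hcard⟩ := gridChannels_finite_and_ncard_le (𝒳 := 𝒳) (𝒴 := 𝒴) N
  refine ⟨gridChannels 𝒳 𝒴 N, hfin, hcard.trans ?_, fun w => ?_⟩
  · rw [← hNdef]
    exact Nat.pow_le_pow_left (by nlinarith) _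
  obtain ⟨w', hw', hle⟩ := exists_mem_gridChannels_le hε hε1 hN0 hN w
  refine ⟨w', hw', ?_⟩
  intro Ω μ 𝓜 _ M X Yw Yw' hYw hYw' hMw hMw' δ α hδ _ hconc δt hδt
  set t : ℝ := 2 ^ (-(n : ℝ) * ε) + 2 ^ (-(n : ℝ) * (α - ε)) with ht
  let L : ℝ := n * Real.logb 2 (Fintype.card 𝒴)
  have hlogY : 1 ≤ Real.logb 2 (Fintype.card 𝒴) := by
    rw [Real.le_logb_iff_rpow_le (by norm_num) (by linarith), Real.rpow_one]
    exact hY0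
  have hL : 2 ≤ L := by
    simp only [L]
    nlinarith
  have hg : ∑ i : (Fin n → 𝒴) × 𝓜, pr μ {ω | M ω = i.2} = 2 ^ L := by
    rw [Fintype.sum_prod_type]
    simp only [sum_pr_eq_one, Finset.sum_const, Finset.card_univ, nsmul_eq_mul, mul_one, L]
    rw [mul_comm, Real.rpow_mul_natCast (by norm_num),
      Real.rpow_logb (by norm_num) (by norm_num) (by linarith)]
    simp
  have htq : t = 2 ^ (-(n * ε)) + 2 ^ (n * ε) * 2 ^ (-(n : ℝ) * α) := by
    rw [ht, ← Real.rpow_add (by norm_num)]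
    congr 2 <;> ring
  rw [pr_eq_sum_filter μ Yw' M (fun y m => |hcs μ Yw' M y m - Hc μ Yw' M| > n * δ)] at hconc
  rw [pr_eq_sum_filter μ Yw M (fun y m => |hcs μ Yw M y m - Hc μ Yw M| > n * δt)]
  have hth : n * δt = (2 + t) * (n * δ + n * ε) + t * L - 2 * t * Real.logb 2 t := by
    rw [hδt, ht]
    simp only [L]
    field_simp
    ring
  rw [hth]
  refine concentration_transfer (fun i => pr_nonneg _ _)
    (fun i => pr_mono μ Set.inter_subset_right) (sum_pr_inter_eq_one μ Yw M)
    (fun i => pr_nonneg _ _) (fun i => pr_mono μ Set.inter_subset_right)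
    (sum_pr_inter_eq_one μ Yw' M) hg hL (by positivity) (by positivity) (fun i => ?_)
    (Hc_eq_sum μ Yw M) (Hc_eq_sum μ Yw' M) hconc htq
  rw [pr_output_inter hYw hMw, pr_output_inter hYw' hMw', Finset.mul_sum]
  refine Finset.sum_le_sum fun x _ => ?_
  rw [mul_left_comm]
  exact mul_le_mul_of_nonneg_left (Channel.pn_le_rpow_mul_pn hle n x i.1) (pr_nonneg _ _)

end Paper
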